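/- arXiv:2003.01255 — 5 statements merged into one kernel-verified Lean document; each statement's English description precedes it below -/
import Mathlib

section
/- Let N ≥ 1, let Φ be a rational self-map of Q̄^N, let Y ⊆ Q̄^N be the common zero set of a finite collection of polynomials in Q̄[x_1, …, x_N], and let x ∈ Q̄^N be a point with well-defined Φ-orbit. Then the return set {n ∈ ℕ : Φ^n(x) ∈ Y} is the union of finitely many arithmetic progressions {a + bk : k ∈ ℕ} (with b ≥ 1) together with a set of upper asymptotic density zero. -/
open MvPolynomial

/-- The field `Q̄` of algebraic numbers, realized as an algebraic closure of `ℚ`. -/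
noncomputable abbrev Qbar : Type := AlgebraicClosure ℚ

/-- The forward orbit of `x ∈ Q̄^N` under the rational self-map of `Q̄^N` given coordinatewise
by the rational functions `pᵢ / qᵢ`. -/
noncomputable def ratOrbit {N : ℕ} (p q : Fin N → MvPolynomial (Fin N) Qbar)
    (x : Fin N → Qbar) : ℕ → (Fin N → Qbar)
  | 0 => x
  | n + 1 => fun i =>
      eval (ratOrbit p q x n) (p i) / eval (ratOrbit p q x n) (q i)

open scoped Classical in
/-- The upper asymptotic (natural) density of a set of natural numbers:
`d̄(A) = limsup_{m → ∞} |A ∩ [1, m]| / m`. -/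
noncomputable def upperDensity (A : Set ℕ) : ℝ :=
  Filter.atTop.limsup fun m : ℕ =>
    (((Finset.Icc 1 m).filter fun n => n ∈ A).card : ℝ) / (m : ℝ)

open Filter Topology

open scoped Classical in
/-- The number of elements of `A` in `[1, m]`. -/
noncomputable def countUpTo (A : Set ℕ) (m : ℕ) : ℕ :=
  ((Finset.Icc 1 m).filter fun n => n ∈ A).card

/-- `A` has natural density zero. -/
def DensityZero (A : Set ℕ) : Prop :=
  Tendsto (fun m : ℕ => (countUpTo A m : ℝ) / (m : ℝ)) atTop (𝓝 0)

theorem DensityZero.upperDensity_eq {A : Set ℕ} (h : DensityZero A) : upperDensity A = 0 :=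
  Tendsto.limsup_eq h

theorem countUpTo_union_le (A B : Set ℕ) (m : ℕ) :
    countUpTo (A ∪ B) m ≤ countUpTo A m + countUpTo B m := by
  classical
  unfold countUpTo
  refine (Finset.card_le_card ?_).trans (Finset.card_union_le _ _)
  intro n
  simp only [Finset.mem_filter, Finset.mem_union, Set.mem_union]
  tauto

theorem countUpTo_mono {A B : Set ℕ} (h : A ⊆ B) (m : ℕ) : countUpTo A m ≤ countUpTo B m := by
  classical
  unfold countUpTo
  exact Finset.card_le_card (Finset.monotone_filter_right _ fun _ _ hn => h hn)

theorem countUpTo_le_shift (A : Set ℕ) (j m : ℕ) :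
    countUpTo A m ≤ countUpTo {n | n + j ∈ A} m + (j + 1) := by
  classical
  unfold countUpTo
  calc _ ≤ (((Finset.Icc 1 m).filter fun n => n ∈ {n | n + j ∈ A}).image (· + j) ∪
        Finset.range (j + 1)).card := Finset.card_le_card ?_
    _ ≤ _ := (Finset.card_union_le _ _).trans
        (add_le_add Finset.card_image_le (Finset.card_range _).le)
  intro n
  simp only [Finset.mem_filter, Finset.mem_union, Finset.mem_image, Finset.mem_Icc,
    Finset.mem_range, Set.mem_ofPred_eq]
  rintro ⟨⟨h1, h2⟩, hA⟩
  by_cases hn : n < j + 1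
  · exact Or.inr hn
  · refine Or.inl ⟨n - j, ⟨by omega, ?_⟩, by omega⟩
    rwa [Nat.sub_add_cancel (by omega)]

/-- A set whose distinct elements are at least `L` apart has at most `m / L + 1` elements
up to `m`. -/
theorem countUpTo_le_of_gaps {A : Set ℕ} {L : ℕ}
    (h : ∀ n ∈ A, ∀ k, 1 ≤ k → k < L → n + k ∉ A) (hL : 0 < L) (m : ℕ) :
    countUpTo A m ≤ m / L + 1 := by
  classical
  unfold countUpTo
  rw [← Finset.card_range (m / L + 1)]
  refine Finset.card_le_card_of_injOn (· / L) ?_ ?_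
  · intro n hn
    simp only [Finset.coe_filter, Finset.mem_Icc, Set.mem_ofPred_eq] at hn
    simpa [Nat.lt_succ_iff] using Nat.div_le_div_right hn.1.2
  · have key : ∀ a ∈ A, ∀ b ∈ A, a / L = b / L → b ≤ a := by
      intro a ha b hb hab
      by_contra hlt
      have ea := Nat.div_add_mod a L
      have eb := Nat.div_add_mod b L
      have la := Nat.mod_lt a hL
      have lb := Nat.mod_lt b hL
      rw [hab] at ea
      refine h a ha (b - a) (by omega) (by omega) ?_
      rwa [Nat.add_sub_cancel' (by omega)]
    intro a ha b hb hab
    simp only [Finset.coe_filter, Set.mem_ofPred_eq] at ha hb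
    exact le_antisymm (key b hb.2 a ha.2 hab.symm) (key a ha.2 b hb.2 hab)

theorem DensityZero.of_countUpTo_le {A B : Set ℕ} {K : ℕ} (hB : DensityZero B)
    (h : ∀ m, countUpTo A m ≤ countUpTo B m + K) : DensityZero A := by
  have hlim := hB.add (tendsto_const_div_atTop_nhds_zero_nat (K : ℝ))
  rw [add_zero] at hlim
  refine squeeze_zero (fun m => by positivity) (fun m => ?_) hlim
  rw [← add_div]
  gcongr
  exact_mod_cast h m

theorem DensityZero.mono {A B : Set ℕ} (hB : DensityZero B) (h : A ⊆ B) : DensityZero A :=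
  hB.of_countUpTo_le (K := 0) fun m => countUpTo_mono h m

theorem densityZero_empty : DensityZero ∅ := by
  simp [DensityZero, countUpTo]

theorem DensityZero.union {A B : Set ℕ} (hA : DensityZero A) (hB : DensityZero B) :
    DensityZero (A ∪ B) := by
  have hlim := hA.add hB
  rw [add_zero] at hlim
  refine squeeze_zero (fun m => by positivity) (fun m => ?_) hlim
  rw [← add_div]
  gcongr
  exact_mod_cast countUpTo_union_le A B m

theorem DensityZero.of_shift {A : Set ℕ} (j : ℕ) (h : DensityZero {n | n + j ∈ A}) :
    DensityZero A :=
  h.of_countUpTo_le (countUpTo_le_shift A j)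

theorem densityZero_Iio (k : ℕ) : DensityZero (Set.Iio k) :=
  DensityZero.of_shift k (by simpa using densityZero_empty)

theorem densityZero_biUnion {ι : Type*} (s : Finset ι) (A : ι → Set ℕ)
    (h : ∀ i ∈ s, DensityZero (A i)) : DensityZero (⋃ i ∈ s, A i) := by
  classical
  induction s using Finset.induction_on with
  | empty => simpa using densityZero_empty
  | insert i s _ ih =>
    rw [Finset.set_biUnion_insert]
    exact (h i (Finset.mem_insert_self i s)).union
      (ih fun j hj => h j (Finset.mem_insert_of_mem hj))

theorem not_densityZero_univ : ¬ DensityZero Set.univ := by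
  intro h
  have h1 : Tendsto (fun m : ℕ => (countUpTo Set.univ m : ℝ) / (m : ℝ)) atTop (𝓝 1) := by
    refine tendsto_const_nhds.congr' ?_
    filter_upwards [eventually_gt_atTop 0] with m hm
    have : (m : ℝ) ≠ 0 := by positivity
    simp [countUpTo, this]
  exact zero_ne_one (tendsto_nhds_unique h h1)

/-- Recurrence: a set not of density zero meets one of its proper shifts in a set not of
density zero. -/
theorem exists_shift_inter_not_densityZero {A : Set ℕ} (hA : ¬ DensityZero A) :
    ∃ k, 1 ≤ k ∧ ¬ DensityZero {n | n ∈ A ∧ n + k ∈ A} := by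
  by_contra! hk
  refine hA (Metric.tendsto_atTop'.2 fun ε hε => ?_)
  obtain ⟨L, hL⟩ := exists_nat_gt (3 / ε)
  have hLpos : (0 : ℝ) < L := (by positivity : (0 : ℝ) < 3 / ε).trans hL
  set C : Set ℕ := ⋃ k ∈ Finset.Ico 1 L, {n | n ∈ A ∧ n + k ∈ A}
  have hCz : DensityZero C :=
    densityZero_biUnion _ _ fun k hkL => hk k (Finset.mem_Ico.1 hkL).1
  have hgap : ∀ n ∈ A \ C, ∀ k, 1 ≤ k → k < L → n + k ∉ A \ C := by
    intro n hn k h1 h2 hnk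
    refine hn.2 (Set.mem_biUnion (Finset.mem_Ico.2 ⟨h1, h2⟩) ⟨hn.1, hnk.1⟩)
  have hCev := (hCz.eventually (gt_mem_nhds (by positivity : (0 : ℝ) < ε / 3)))
  have h1ev := (tendsto_const_div_atTop_nhds_zero_nat (1 : ℝ)).eventually
    (gt_mem_nhds (by positivity : (0 : ℝ) < ε / 3))
  obtain ⟨M, hM⟩ := eventually_atTop.1 ((hCev.and h1ev).and (eventually_gt_atTop 0))
  refine ⟨M, fun m hm => ?_⟩
  obtain ⟨⟨hCm, h1m⟩, hm0⟩ := hM m hm.le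
  have hm0' : (0 : ℝ) < m := by exact_mod_cast hm0
  have hcount : countUpTo A m ≤ (m / L + 1) + countUpTo C m := by
    have hsub : A ⊆ (A \ C) ∪ C := by simp
    refine (countUpTo_mono hsub m).trans ((countUpTo_union_le _ _ m).trans ?_)
    gcongr
    exact countUpTo_le_of_gaps hgap (by exact_mod_cast hLpos) m
  have hcast : (countUpTo A m : ℝ) ≤ (m / L + 1) + countUpTo C m := by
    have : (countUpTo A m : ℝ) ≤ ((m / L : ℕ) + 1) + countUpTo C m := by exact_mod_cast hcount
    have h2 : ((m / L : ℕ) : ℝ) ≤ m / L := Nat.cast_div_le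
    linarith
  have hdiv : (countUpTo A m : ℝ) / m ≤ 1 / L + 1 / m + countUpTo C m / m := by
    calc (countUpTo A m : ℝ) / m ≤ ((m / L + 1) + countUpTo C m) / m := by gcongr
      _ = _ := by field_simp
  have hLε : (1 : ℝ) / L < ε / 3 := by
    rw [div_lt_iff₀ hε] at hL
    rw [div_lt_iff₀ hLpos]
    linarith
  rw [Real.dist_eq, sub_zero, abs_of_nonneg (by positivity)]
  linarith

/-- The times at which the sequence `x` lies in the zero locus of the ideal `I`. -/
def vanishingTimes {K σ : Type*} [Field K] (x : ℕ → σ → K) (I : Ideal (MvPolynomial σ K)) :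
    Set ℕ :=
  {n | ∀ P ∈ I, eval (x n) P = 0}

/-- An ideal which is maximal among those whose vanishing times do not have density zero. -/
theorem exists_ideal_maximal_not_densityZero {K σ : Type*} [Field K] [Finite σ]
    (x : ℕ → σ → K) :
    ∃ I : Ideal (MvPolynomial σ K), ¬ DensityZero (vanishingTimes x I) ∧
      ∀ P, ¬ DensityZero {n | n ∈ vanishingTimes x I ∧ eval (x n) P = 0} → P ∈ I := by
  have hne : {I : Ideal (MvPolynomial σ K) | ¬ DensityZero (vanishingTimes x I)}.Nonempty := by
    refine ⟨⊥, ?_⟩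
    have : vanishingTimes x (⊥ : Ideal (MvPolynomial σ K)) = Set.univ := by
      ext n
      simp [vanishingTimes]
    simpa [this] using not_densityZero_univ
  obtain ⟨I, hI, hmax⟩ := set_has_maximal_iff_noetherian.2
    (inferInstance : IsNoetherian (MvPolynomial σ K) (MvPolynomial σ K)) _ hne
  refine ⟨I, hI, fun P hP => ?_⟩
  by_contra hPI
  refine hmax (I ⊔ Ideal.span {P}) (fun hz => hP (hz.mono ?_)) (left_lt_sup.2 fun hle =>
    hPI (hle (Ideal.mem_span_singleton_self P)))
  rintro n ⟨hn, hnP⟩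
  have hle : I ⊔ Ideal.span {P} ≤ RingHom.ker (eval (x n)) :=
    sup_le (fun Q hQ => hn Q hQ) ((Ideal.span_singleton_le_iff_mem _).2 hnP)
  exact fun Q hQ => hle hQ

/-- The dynamical Mordell–Lang property up to density zero for any sequence along which
vanishing of a polynomial at the next term is again a polynomial condition. -/
theorem returnTimes_eq_progressions_union_densityZero {K σ : Type*} [Field K] [Finite σ]
    (x : ℕ → σ → K)
    (hpull : ∀ P : MvPolynomial σ K, ∃ P' : MvPolynomial σ K,
      ∀ n, eval (x n) P' = 0 ↔ eval (x (n + 1)) P = 0)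
    (F : Set (MvPolynomial σ K)) :
    ∃ (r : ℕ) (a b : Fin r → ℕ) (S : Set ℕ),
      (∀ i, 1 ≤ b i) ∧ DensityZero S ∧
      {n : ℕ | ∀ P ∈ F, eval (x n) P = 0} =
        (⋃ i : Fin r, {m : ℕ | ∃ t : ℕ, m = a i + b i * t}) ∪ S := by
  classical
  have hpulls : ∀ (k : ℕ) (P : MvPolynomial σ K), ∃ P' : MvPolynomial σ K,
      ∀ n, eval (x n) P' = 0 ↔ eval (x (n + k)) P = 0 := by
    intro k
    induction k with
    | zero => exact fun P => ⟨P, fun n => Iff.rfl⟩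
    | succ k ih =>
      intro P
      obtain ⟨P₁, h₁⟩ := hpull P
      obtain ⟨P₂, h₂⟩ := ih P₁
      exact ⟨P₂, fun n => (h₂ n).trans (h₁ (n + k))⟩
  obtain ⟨I, hI, hmax⟩ := exists_ideal_maximal_not_densityZero x
  obtain ⟨k, hk, hrec⟩ := exists_shift_inter_not_densityZero hI
  have hinv : ∀ n ∈ vanishingTimes x I, n + k ∈ vanishingTimes x I := by
    intro n hn P hP
    obtain ⟨P', hP'⟩ := hpulls k P
    refine (hP' n).1 (hn P' (hmax P' fun hz => hrec (hz.mono ?_)))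
    exact fun m hm => ⟨hm.1, (hP' m).2 (hm.2 P hP)⟩
  obtain ⟨n₀, hn₀⟩ : (vanishingTimes x I).Nonempty := by
    rw [Set.nonempty_iff_ne_empty]
    exact fun h => hI (h ▸ densityZero_empty)
  have hprog : ∀ t, n₀ + k * t ∈ vanishingTimes x I := by
    intro t
    induction t with
    | zero => simpa using hn₀
    | succ t ih => simpa [mul_add, add_assoc] using hinv _ ih
  set R : Set ℕ := {n : ℕ | ∀ P ∈ F, eval (x n) P = 0}
  let A : ℕ → Set ℕ := fun j => {n | n ∈ R ∧ ∃ t, n = n₀ + j + k * t}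
  have hdich : ∀ j, ¬ DensityZero (A j) → ∀ t, n₀ + j + k * t ∈ R := by
    intro j hj t P hP
    obtain ⟨P', hP'⟩ := hpulls j P
    have hmem : P' ∈ I := by
      refine hmax P' fun hz => hj (DensityZero.of_shift j (hz.mono ?_))
      rintro n ⟨hnR, s, hs⟩
      obtain rfl : n = n₀ + k * s := by omega
      exact ⟨hprog s, (hP' _).2 (hnR P hP)⟩
    have := (hP' _).1 (hprog t P' hmem)
    rwa [add_right_comm] at this
  let G : Finset ℕ := (Finset.range k).filter fun j => ¬ DensityZero (A j)
  let e : Fin G.card ≃ G := G.equivFin.symm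
  let T : Set ℕ := ⋃ i : Fin G.card, {m : ℕ | ∃ t : ℕ, m = (n₀ + (e i : ℕ)) + k * t}
  have hTR : T ⊆ R := by
    intro m hm
    obtain ⟨i, t, rfl⟩ := Set.mem_iUnion.1 hm
    exact hdich _ (Finset.mem_filter.1 (e i).2).2 t
  refine ⟨G.card, fun i => n₀ + (e i : ℕ), fun _ => k, R \ T, fun _ => hk, ?_,
    (Set.union_sdiff_cancel hTR).symm⟩
  refine ((densityZero_Iio n₀).union (densityZero_biUnion
    ((Finset.range k).filter fun j => DensityZero (A j)) A
    fun j hj => (Finset.mem_filter.1 hj).2)).mono ?_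
  rintro n ⟨hnR, hnT⟩
  by_cases hn : n < n₀
  · exact Or.inl hn
  have hlt : (n - n₀) % k < k := Nat.mod_lt _ hk
  have hn_eq : n = n₀ + (n - n₀) % k + k * ((n - n₀) / k) := by
    have := Nat.mod_add_div (n - n₀) k
    omega
  refine Or.inr (Set.mem_biUnion (x := (n - n₀) % k) ?_ ⟨hnR, _, hn_eq⟩)
  refine Finset.mem_filter.2 ⟨Finset.mem_range.2 hlt, ?_⟩
  by_contra hz
  refine hnT (Set.mem_iUnion.2
    ⟨e.symm ⟨_, Finset.mem_filter.2 ⟨Finset.mem_range.2 hlt, hz⟩⟩, (n - n₀) / k, ?_⟩)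
  simpa using hn_eq

/-- Clearing denominators in the pullback of a polynomial along a rational map. -/
theorem exists_pullback_numerator {N : ℕ} (p q : Fin N → MvPolynomial (Fin N) Qbar)
    (x : Fin N → Qbar) (hwellq : ∀ n i, eval (ratOrbit p q x n) (q i) ≠ 0)
    (P : MvPolynomial (Fin N) Qbar) :
    ∃ P' D : MvPolynomial (Fin N) Qbar, ∀ n, eval (ratOrbit p q x n) D ≠ 0 ∧
      eval (ratOrbit p q x n) P' =
        eval (ratOrbit p q x (n + 1)) P * eval (ratOrbit p q x n) D := by
  induction P using MvPolynomial.induction_on with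
  | C c => exact ⟨C c, 1, fun n => by simp⟩
  | add P₁ P₂ h₁ h₂ =>
    obtain ⟨P₁', D₁, h₁⟩ := h₁
    obtain ⟨P₂', D₂, h₂⟩ := h₂
    refine ⟨P₁' * D₂ + P₂' * D₁, D₁ * D₂, fun n => ⟨?_, ?_⟩⟩
    · simpa using ⟨(h₁ n).1, (h₂ n).1⟩
    · simp only [map_add, map_mul, (h₁ n).2, (h₂ n).2]
      ring
  | mul_X P i h =>
    obtain ⟨P', D, h⟩ := h
    refine ⟨P' * p i, D * q i, fun n => ⟨?_, ?_⟩⟩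
    · simpa using ⟨(h n).1, hwellq n i⟩
    · have hx : ratOrbit p q x (n + 1) i * eval (ratOrbit p q x n) (q i) =
          eval (ratOrbit p q x n) (p i) := div_mul_cancel₀ _ (hwellq n i)
      simp only [map_mul, eval_X, (h n).2, ← hx]
      ring

/-- **Weak Dynamical Mordell–Lang** (Theorem 1.7 of Bell–Hu–Satriano).
Let `Φ = (p₁/q₁, …, p_N/q_N)` be a rational self-map of `Q̄^N`, let `Y ⊆ Q̄^N` be the common
zero set of a finite collection `F` of polynomials, and let `x ∈ Q̄^N` have well-defined
`Φ`-orbit. Then the return set `{n ∈ ℕ : Φⁿ(x) ∈ Y}` is the union of finitely many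
arithmetic progressions `{aᵢ + bᵢ k : k ∈ ℕ}` (with `bᵢ ≥ 1`) together with a set of upper
asymptotic density zero. -/
theorem weak_dynamical_mordell_lang
    {N : ℕ} (hN : 1 ≤ N)
    (p q : Fin N → MvPolynomial (Fin N) Qbar) (hq : ∀ i, q i ≠ 0)
    (F : Finset (MvPolynomial (Fin N) Qbar))
    (x : Fin N → Qbar)
    (hwellq : ∀ n i, eval (ratOrbit p q x n) (q i) ≠ 0) :
    ∃ (r : ℕ) (a b : Fin r → ℕ) (S : Set ℕ),
      (∀ i, 1 ≤ b i) ∧ upperDensity S = 0 ∧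
      {n : ℕ | ∀ P ∈ F, eval (ratOrbit p q x n) P = 0} =
        (⋃ i : Fin r, {m : ℕ | ∃ t : ℕ, m = a i + b i * t}) ∪ S := by
  obtain ⟨r, a, b, S, hb, hS, h⟩ :=
    returnTimes_eq_progressions_union_densityZero (ratOrbit p q x) (fun P => by
      obtain ⟨P', D, hPD⟩ := exists_pullback_numerator p q x hwellq P
      exact ⟨P', fun n => by simp [(hPD n).2, (hPD n).1]⟩) (F : Set _)
  exact ⟨r, a, b, S, hb, hS.upperDensity_eq, by simpa using h⟩
end

section
/- Let N ≥ 1, let Φ be a rational self-map of Q̄^N, and let f be a rational function on Q̄^N. Then there exists a constant ℓ ∈ ℕ with the following property: if x, y ∈ Q̄^N both have well-defined (Φ, f)-orbits and f(Φ^n(x)) = f(Φ^n(y)) for all 0 ≤ n ≤ ℓ, then f(Φ^n(x)) = f(Φ^n(y)) for all n ≥ 0. -/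
open MvPolynomial

/-- `F` agrees on `W` with a quotient of polynomials whose denominator vanishes nowhere on `W`. -/
def IsPolyQuotOn {K σ : Type*} [Field K] (W : Set (σ → K)) (F : (σ → K) → K) : Prop :=
  ∃ A B : MvPolynomial σ K, ∀ x ∈ W, eval x B ≠ 0 ∧ F x = eval x A / eval x B

namespace IsPolyQuotOn

variable {K σ τ : Type*} [Field K] {W : Set (σ → K)} {F G : (σ → K) → K}

theorem of_poly (P : MvPolynomial σ K) : IsPolyQuotOn W (fun x => eval x P) :=
  ⟨P, 1, fun x _ => by simp⟩

theorem add (hF : IsPolyQuotOn W F) (hG : IsPolyQuotOn W G) :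
    IsPolyQuotOn W (fun x => F x + G x) := by
  obtain ⟨A, B, hF⟩ := hF
  obtain ⟨C, D, hG⟩ := hG
  refine ⟨A * D + B * C, B * D, fun x hx => ?_⟩
  obtain ⟨hB, hFx⟩ := hF x hx
  obtain ⟨hD, hGx⟩ := hG x hx
  simp only [map_mul, map_add]
  exact ⟨mul_ne_zero hB hD, by rw [hFx, hGx, div_add_div _ _ hB hD]⟩

theorem mul (hF : IsPolyQuotOn W F) (hG : IsPolyQuotOn W G) :
    IsPolyQuotOn W (fun x => F x * G x) := by
  obtain ⟨A, B, hF⟩ := hF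
  obtain ⟨C, D, hG⟩ := hG
  refine ⟨A * C, B * D, fun x hx => ?_⟩
  obtain ⟨hB, hFx⟩ := hF x hx
  obtain ⟨hD, hGx⟩ := hG x hx
  simp only [map_mul]
  exact ⟨mul_ne_zero hB hD, by rw [hFx, hGx, div_mul_div_comm]⟩

theorem div (hF : IsPolyQuotOn W F) (hG : IsPolyQuotOn W G) (hG0 : ∀ x ∈ W, G x ≠ 0) :
    IsPolyQuotOn W (fun x => F x / G x) := by
  obtain ⟨A, B, hF⟩ := hF
  obtain ⟨C, D, hG⟩ := hG
  refine ⟨A * D, B * C, fun x hx => ?_⟩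
  obtain ⟨hB, hFx⟩ := hF x hx
  obtain ⟨hD, hGx⟩ := hG x hx
  have hC : eval x C ≠ 0 := fun h0 => hG0 x hx (by rw [hGx, h0, zero_div])
  simp only [map_mul]
  exact ⟨mul_ne_zero hB hC, by rw [hFx, hGx, div_div_div_eq]⟩

theorem eval_comp {u : (σ → K) → τ → K} (hu : ∀ i, IsPolyQuotOn W (fun x => u x i))
    (P : MvPolynomial τ K) : IsPolyQuotOn W (fun x => eval (u x) P) := by
  induction P using MvPolynomial.induction_on with
  | C a => simpa using of_poly (W := W) (C a)
  | add P Q hP hQ => simpa using hP.add hQ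
  | mul_X P i hP => simpa using hP.mul (hu i)

end IsPolyQuotOn

theorem isPolyQuotOn_ratOrbit {N : ℕ} (p q : Fin N → MvPolynomial (Fin N) Qbar)
    {W : Set (Fin N → Qbar)} (hW : ∀ x ∈ W, ∀ n i, eval (ratOrbit p q x n) (q i) ≠ 0) (n : ℕ) :
    ∀ i, IsPolyQuotOn W (fun x => ratOrbit p q x n i) := by
  induction n with
  | zero => exact fun i => by simpa [ratOrbit] using IsPolyQuotOn.of_poly (W := W) (X i)
  | succ n ih =>
    exact fun i => (IsPolyQuotOn.eval_comp ih (p i)).div (IsPolyQuotOn.eval_comp ih (q i))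
      fun x hx => hW x hx n i

/-- In a Noetherian ring, every term of a sequence lies in the ideal spanned by some fixed
initial segment of it. -/
theorem exists_forall_mem_span_image_Iic {R : Type*} [CommRing R] [IsNoetherianRing R]
    (E : ℕ → R) : ∃ l : ℕ, ∀ n, E n ∈ Ideal.span (E '' Set.Iic l) := by
  let I : ℕ →o Ideal R :=
    ⟨fun m => Ideal.span (E '' Set.Iic m), fun _ _ hab =>
      Ideal.span_mono (Set.image_mono (Set.Iic_subset_Iic.2 hab))⟩
  obtain ⟨l, hl⟩ := WellFoundedGT.monotone_chain_condition I
  refine ⟨l, fun n => ?_⟩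
  change E n ∈ I l
  rw [hl (max l n) (le_max_left _ _)]
  exact Ideal.subset_span ⟨n, le_max_right l n, rfl⟩

/-- A sequence of polynomial quotients on `W` that agree at two points up to a suitable index
agree there at all indices. -/
theorem exists_forall_eq_of_isPolyQuotOn {K σ : Type*} [Field K] [Finite σ]
    {W : Set (σ → K)} {F : ℕ → (σ → K) → K} (hF : ∀ n, IsPolyQuotOn W (F n)) :
    ∃ l : ℕ, ∀ x ∈ W, ∀ y ∈ W, (∀ n ≤ l, F n x = F n y) → ∀ n, F n x = F n y := by
  choose A B hAB using hF
  let E : ℕ → MvPolynomial (σ ⊕ σ) K := fun n =>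
    rename Sum.inl (A n) * rename Sum.inr (B n) - rename Sum.inr (A n) * rename Sum.inl (B n)
  obtain ⟨l, hl⟩ := exists_forall_mem_span_image_Iic E
  refine ⟨l, fun x hx y hy hxy n => ?_⟩
  have key (m : ℕ) : F m x = F m y ↔ eval (Sum.elim x y) (E m) = 0 := by
    obtain ⟨hBx, hFx⟩ := hAB m x hx
    obtain ⟨hBy, hFy⟩ := hAB m y hy
    rw [hFx, hFy, div_eq_div_iff hBx hBy]
    simp [E, eval_rename, Function.comp_def, sub_eq_zero]
  have hle : Ideal.span (E '' Set.Iic l) ≤ RingHom.ker (eval (Sum.elim x y)) := by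
    rw [Ideal.span_le]
    rintro _ ⟨m, hm, rfl⟩
    exact (key m).1 (hxy m hm)
  exact (key n).2 (hle (hl n))

/-- **Truncated orbits determine orbits** (Lemma 2.2 of Bell–Hu–Satriano).
Let `Φ = (p₁/q₁, …, p_N/q_N)` be a rational self-map of `Q̄^N` and let `f = g/h` be a
rational function on `Q̄^N`. Then there is a constant `ℓ ∈ ℕ` such that whenever
`x, y ∈ Q̄^N` both have well-defined `(Φ, f)`-orbits and `f(Φⁿ(x)) = f(Φⁿ(y))` for all
`0 ≤ n ≤ ℓ`, then `f(Φⁿ(x)) = f(Φⁿ(y))` for all `n ≥ 0`. -/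
theorem truncated_orbit
    {N : ℕ} (hN : 1 ≤ N)
    (p q : Fin N → MvPolynomial (Fin N) Qbar) (hq : ∀ i, q i ≠ 0)
    (g h : MvPolynomial (Fin N) Qbar) (hh : h ≠ 0) :
    ∃ ℓ : ℕ, ∀ x y : Fin N → Qbar,
      (∀ n i, eval (ratOrbit p q x n) (q i) ≠ 0) →
      (∀ n, eval (ratOrbit p q x n) h ≠ 0) →
      (∀ n i, eval (ratOrbit p q y n) (q i) ≠ 0) →
      (∀ n, eval (ratOrbit p q y n) h ≠ 0) →
      (∀ n ≤ ℓ,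
        eval (ratOrbit p q x n) g / eval (ratOrbit p q x n) h =
          eval (ratOrbit p q y n) g / eval (ratOrbit p q y n) h) →
      ∀ n : ℕ,
        eval (ratOrbit p q x n) g / eval (ratOrbit p q x n) h =
          eval (ratOrbit p q y n) g / eval (ratOrbit p q y n) h := by
  obtain ⟨l, hl⟩ := exists_forall_eq_of_isPolyQuotOn
    (W := {x : Fin N → Qbar | (∀ n i, eval (ratOrbit p q x n) (q i) ≠ 0) ∧
      ∀ n, eval (ratOrbit p q x n) h ≠ 0})
    (F := fun n x => eval (ratOrbit p q x n) g / eval (ratOrbit p q x n) h) fun n =>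
      have hu := isPolyQuotOn_ratOrbit p q (fun _ hx => hx.1) n
      (IsPolyQuotOn.eval_comp hu g).div (IsPolyQuotOn.eval_comp hu h) fun _ hx => hx.2 n
  exact ⟨l, fun x y hx hx' hy hy' => hl x ⟨hx, hx'⟩ y ⟨hy, hy'⟩⟩
end

section
/- Let T ⊆ ℕ and let N be a positive integer with d̄(T) > 1/N. Then for any finite subset F ⊆ ℕ with |F| ≥ N, there exist j, k ∈ F with j > k such that d̄((T + (j − k)) ∩ T) > 0. -/
open scoped Classical in
/-- The number of elements of `A` in `[1, m]`. -/
noncomputable def initialCount (A : Set ℕ) (m : ℕ) : ℕ :=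
  ((Finset.Icc 1 m).filter fun n => n ∈ A).card

theorem initialCount_le (A : Set ℕ) (m : ℕ) : initialCount A m ≤ m := by
  classical
  exact (Finset.card_filter_le _ _).trans (by simp)

theorem isBoundedUnder_le_initialCount_div (A : Set ℕ) :
    Filter.atTop.IsBoundedUnder (· ≤ ·) fun m : ℕ => (initialCount A m : ℝ) / m :=
  Filter.isBoundedUnder_of ⟨1, fun m =>
    div_le_one_of_le₀ (by exact_mod_cast initialCount_le A m) (Nat.cast_nonneg m)⟩

theorem isCoboundedUnder_le_initialCount_div (A : Set ℕ) :
    Filter.atTop.IsCoboundedUnder (· ≤ ·) fun m : ℕ => (initialCount A m : ℝ) / m :=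
  Filter.IsBoundedUnder.isCoboundedUnder_le (Filter.isBoundedUnder_of ⟨0, fun _ => by positivity⟩)

theorem eventually_initialCount_le {A : Set ℕ} {ε : ℝ} (h : upperDensity A < ε) :
    ∀ᶠ m : ℕ in Filter.atTop, (initialCount A m : ℝ) ≤ ε * m := by
  have h' := Filter.eventually_lt_of_limsup_lt h (isBoundedUnder_le_initialCount_div A)
  filter_upwards [h', Filter.eventually_gt_atTop 0] with m hm hm0
  exact ((div_lt_iff₀ (Nat.cast_pos.2 hm0)).1 hm).le

theorem frequently_le_initialCount {A : Set ℕ} {c : ℝ} (h : c < upperDensity A) :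
    ∃ᶠ m : ℕ in Filter.atTop, c * m ≤ (initialCount A m : ℝ) := by
  have h' := Filter.frequently_lt_of_lt_limsup (isCoboundedUnder_le_initialCount_div A) h
  refine (h'.and_eventually (Filter.eventually_gt_atTop 0)).mono fun m ⟨hm, hm0⟩ => ?_
  exact ((lt_div_iff₀ (Nat.cast_pos.2 hm0)).1 hm).le

/-- A Bonferroni-type inequality: sets with small pairwise intersections have a union almost as
large as the sum of their sizes. -/
theorem sum_card_le_card_biUnion_add {ι α : Type*} [LinearOrder ι] [DecidableEq α]
    (F : Finset ι) (A : ι → Finset α) {b : ℝ} (hb : 0 ≤ b)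
    (h : ∀ j ∈ F, ∀ k ∈ F, k < j → ((A j ∩ A k).card : ℝ) ≤ b) :
    ∑ j ∈ F, ((A j).card : ℝ) ≤ (F.biUnion A).card + (F.card : ℝ) ^ 2 * b := by
  induction F using Finset.induction_on_max with
  | empty => simp
  | insert a s ha ih =>
    have has : a ∉ s := fun hs => lt_irrefl a (ha a hs)
    have ih := ih fun j hj k hk =>
      h j (Finset.mem_insert_of_mem hj) k (Finset.mem_insert_of_mem hk)
    have hinter : ((A a ∩ s.biUnion A).card : ℝ) ≤ s.card * b := by
      rw [Finset.inter_biUnion]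
      calc ((s.biUnion fun k => A a ∩ A k).card : ℝ)
          ≤ ∑ k ∈ s, ((A a ∩ A k).card : ℝ) := by exact_mod_cast Finset.card_biUnion_le
        _ ≤ ∑ _k ∈ s, b := Finset.sum_le_sum fun k hk =>
            h a (Finset.mem_insert_self a s) k (Finset.mem_insert_of_mem hk) (ha k hk)
        _ = s.card * b := by simp
    have hunion : ((A a ∪ s.biUnion A).card : ℝ) + (A a ∩ s.biUnion A).card
        = (A a).card + (s.biUnion A).card := by
      exact_mod_cast Finset.card_union_add_card_inter _ _
    rw [Finset.sum_insert has, Finset.biUnion_insert, Finset.card_insert_of_notMem has]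
    push_cast
    have hsb : 0 ≤ (s.card : ℝ) * b := by positivity
    linarith [show ((s.card : ℝ) + 1) ^ 2 * b
      = (s.card : ℝ) ^ 2 * b + s.card * b + s.card * b + b by ring]

theorem initialCount_le_initialCount_image_add (T : Set ℕ) (j m : ℕ) :
    initialCount T m ≤ initialCount ((fun t => t + j) '' T) m + j := by
  classical
  unfold initialCount
  have hsub : ((Finset.Icc 1 m).filter fun n => n ∈ T) ⊆
      (((Finset.Icc 1 m).filter fun n => n ∈ (fun t => t + j) '' T).image fun n => n - j) ∪
        Finset.Ioc (m - j) m := by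
    intro t ht
    simp only [Finset.mem_filter, Finset.mem_Icc] at ht
    simp only [Finset.mem_union, Finset.mem_image, Finset.mem_filter, Finset.mem_Icc,
      Finset.mem_Ioc]
    by_cases htj : t + j ≤ m
    · exact Or.inl ⟨t + j, ⟨⟨by omega, htj⟩, t, ht.2, rfl⟩, by omega⟩
    · exact Or.inr ⟨by omega, ht.1.2⟩
  refine (Finset.card_le_card hsub).trans ((Finset.card_union_le _ _).trans ?_)
  exact Nat.add_le_add Finset.card_image_le (by rw [Nat.card_Ioc]; omega)

theorem initialCount_image_add_inter_image_add_le (T : Set ℕ) {j k : ℕ} (hkj : k < j) (m : ℕ) :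
    initialCount ((fun t => t + j) '' T ∩ (fun t => t + k) '' T) m ≤
      initialCount ((fun t => t + (j - k)) '' T ∩ T) m := by
  classical
  refine Finset.card_le_card_of_injOn (fun n => n - k) ?_ ?_
  · intro x hx
    simp only [Finset.coe_filter, Finset.mem_Icc, Set.mem_ofPred_eq] at hx ⊢
    obtain ⟨hx1, ⟨t, ht, rfl⟩, s, hs, hst⟩ := hx
    dsimp only at hx1 hst ⊢
    have hsk : t + j - k = s := by omega
    refine ⟨by omega, ⟨t, ht, by dsimp only; omega⟩, by simpa only [hsk] using hs⟩
  · intro x hx y hy hxy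
    simp only [Finset.coe_filter, Finset.mem_Icc, Set.mem_ofPred_eq] at hx hy hxy
    obtain ⟨-, -, s, -, rfl⟩ := hx
    obtain ⟨-, -, t, -, rfl⟩ := hy
    simp only at hxy ⊢
    omega

theorem card_mul_initialCount_le (T : Set ℕ) (F : Finset ℕ) (m : ℕ) {b : ℝ} (hb : 0 ≤ b)
    (h : ∀ j ∈ F, ∀ k ∈ F, k < j →
      (initialCount ((fun t => t + (j - k)) '' T ∩ T) m : ℝ) ≤ b) :
    (F.card : ℝ) * initialCount T m ≤ m + (F.card : ℝ) ^ 2 * b + ∑ j ∈ F, (j : ℝ) := by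
  classical
  let A : ℕ → Finset ℕ := fun j => (Finset.Icc 1 m).filter fun n => n ∈ (fun t => t + j) '' T
  have hA : ∑ j ∈ F, ((A j).card : ℝ) ≤ (F.biUnion A).card + (F.card : ℝ) ^ 2 * b := by
    refine sum_card_le_card_biUnion_add F A hb fun j hj k hk hkj => ?_
    refine le_trans ?_ (h j hj k hk hkj)
    refine le_trans (Nat.cast_le.2 (le_of_eq ?_))
      (Nat.cast_le.2 (initialCount_image_add_inter_image_add_le T hkj m))
    unfold initialCount
    rw [← Finset.filter_and]
    congr
  have hU : ((F.biUnion A).card : ℝ) ≤ m := by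
    have hsub : F.biUnion A ⊆ Finset.Icc 1 m :=
      Finset.biUnion_subset.2 fun j _ => Finset.filter_subset _ _
    exact_mod_cast (Finset.card_le_card hsub).trans (by simp)
  have hsum : ∑ _j ∈ F, (initialCount T m : ℝ) ≤ ∑ j ∈ F, (((A j).card : ℝ) + j) := by
    refine Finset.sum_le_sum fun j _ => ?_
    have := initialCount_le_initialCount_image_add T j m
    unfold initialCount at this ⊢
    dsimp only [A]
    exact_mod_cast this
  rw [Finset.sum_const, nsmul_eq_mul, Finset.sum_add_distrib] at hsum
  linarith

/-- **Lemma 3.5 of Bell–Hu–Satriano**: let `T ⊆ ℕ` and let `N` be a positive integer with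
`d̄(T) > 1/N`. Then for any finite set `F ⊆ ℕ` with `|F| ≥ N`, there exist `j, k ∈ F` with
`j > k` such that `d̄((T + (j − k)) ∩ T) > 0`. -/
theorem exists_shift_pos_density
    (T : Set ℕ) (N : ℕ) (hN : 0 < N) (hT : 1 / (N : ℝ) < upperDensity T)
    (F : Finset ℕ) (hF : N ≤ F.card) :
    ∃ j ∈ F, ∃ k ∈ F, k < j ∧
      0 < upperDensity (((fun t => t + (j - k)) '' T) ∩ T) := by
  by_contra! hcon
  obtain ⟨c, hc, hcT⟩ := exists_between hT
  have hN' : (0 : ℝ) < N := Nat.cast_pos.2 hN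
  have hFN : (N : ℝ) ≤ F.card := Nat.cast_le.2 hF
  have hF0 : (0 : ℝ) < F.card := hN'.trans_le hFN
  have hδ : 0 < F.card * c - 1 := by
    have := (div_lt_iff₀ hN').1 hc
    nlinarith [(by positivity : (0 : ℝ) < 1 / N)]
  set δ : ℝ := F.card * c - 1 with hδ_def
  set ε : ℝ := δ / (2 * (F.card : ℝ) ^ 2) with hε_def
  have hε : 0 < ε := by positivity
  have hεδ : (F.card : ℝ) ^ 2 * ε = δ / 2 := by
    rw [hε_def]
    field_simp
  have hsmall : ∀ᶠ m : ℕ in Filter.atTop, ∀ j ∈ F, ∀ k ∈ F, k < j →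
      (initialCount ((fun t => t + (j - k)) '' T ∩ T) m : ℝ) ≤ ε * m := by
    simp only [Filter.eventually_all_finset, Filter.eventually_all]
    exact fun j hj k hk hkj => eventually_initialCount_le ((hcon j hj k hk hkj).trans_lt hε)
  have hlarge : ∀ᶠ m : ℕ in Filter.atTop, 2 * (∑ j ∈ F, (j : ℝ)) / δ < m :=
    tendsto_natCast_atTop_atTop.eventually_gt_atTop _
  obtain ⟨m, hmT, hm, hm'⟩ :=
    ((frequently_le_initialCount hcT).and_eventually (hsmall.and hlarge)).exists
  have key := card_mul_initialCount_le T F m (by positivity) hm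
  rw [div_lt_iff₀ hδ] at hm'
  have hlow : (1 + δ) * m ≤ (F.card : ℝ) * initialCount T m := by
    calc (1 + δ) * m = F.card * (c * m) := by rw [hδ_def]; ring
      _ ≤ _ := mul_le_mul_of_nonneg_left hmT hF0.le
  rw [← mul_assoc, hεδ] at key
  linarith
end

section
/- Let U be a non-empty Noetherian topological space of Krull dimension d < ∞ and Φ : U → U a continuous map. Suppose Z_0 ⊇ Z_1 ⊇ ⋯ ⊇ Z_m is a descending chain of closed subsets of U, each of which is not periodic with respect to Φ, such that ν(Z_0) ≻ ν(Z_1) ≻ ⋯ ≻ ν(Z_m). Then m < (d + 1)². -/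
section TopDyn

variable {U : Type*} [TopologicalSpace U]

/-- A subset `Y` is periodic with respect to `Φ` if `Φ^n(Y) ⊆ Y` for some `n ≥ 1`. -/
def IsPeriodicUnder (Φ : U → U) (Y : Set U) : Prop :=
  ∃ n : ℕ, 1 ≤ n ∧ Φ^[n] '' Y ⊆ Y

/-- The irreducible components of a closed subset `Z`: the maximal closed irreducible
subsets of `Z`. -/
def irrComps (Z : Set U) : Set (Set U) :=
  {C : Set U | Maximal (fun S => S ⊆ Z ∧ IsIrreducible S ∧ IsClosed S) C}

/-- `P_Φ(Z)`: the unique maximal `Φ`-periodic union of a subcollection of the irreducible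
components of `Z` (realized as the union of all `Φ`-periodic unions of subcollections). -/
def PPhi (Φ : U → U) (Z : Set U) : Set U :=
  ⋃₀ {Y : Set U | (∃ S ⊆ irrComps Z, Y = ⋃₀ S) ∧ IsPeriodicUnder Φ Y}

/-- The set of irreducible components of `Z` that are not contained in `P_Φ(Z)`. -/
def nonPeriodicComps (Φ : U → U) (Z : Set U) : Set (Set U) :=
  {C ∈ irrComps Z | ¬ C ⊆ PPhi Φ Z}

/-- The stabilized (i.e., limiting, realized as the infimum) value of the weakly decreasing
sequence `dim closure(Φ^n(C))`. -/
noncomputable def stabDim (Φ : U → U) (C : Set U) : WithBot ℕ∞ :=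
  ⨅ n : ℕ, topologicalKrullDim ↥(closure (Φ^[n] '' C))

open scoped Classical in
/-- The stable non-periodic dimension `ν(Z)` of a closed set `Z`: the maximum, in the
lexicographic order (with `⊥` playing the role of `−∞`), of the pairs
`(stabilized dim closure(Φ^n(C)), dim C)` over the irreducible components `C` of `Z` not
contained in `P_Φ(Z)`; it is `(⊥, ⊥)` if there are no such components. -/
noncomputable def nuDim (Φ : U → U) (Z : Set U) : (WithBot ℕ∞) × (WithBot ℕ∞) :=
  let D : WithBot ℕ∞ := ⨆ C ∈ nonPeriodicComps Φ Z, stabDim Φ C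
  (D, ⨆ C ∈ nonPeriodicComps Φ Z,
    if stabDim Φ C = D then topologicalKrullDim ↥C else ⊥)

/-- The lexicographic (strict) order on pairs: `(a, b) ≺ (a', b')` iff `a < a'`, or
`a = a'` and `b < b'`. -/
def nuLt (a b : (WithBot ℕ∞) × (WithBot ℕ∞)) : Prop :=
  a.1 < b.1 ∨ (a.1 = b.1 ∧ a.2 < b.2)

end TopDyn

theorem image_iterate_mul_subset {α : Type*} {Φ : α → α} {Y : Set α} {n : ℕ}
    (h : Φ^[n] '' Y ⊆ Y) (k : ℕ) : Φ^[n * k] '' Y ⊆ Y := by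
  rw [Function.iterate_mul]
  exact ((Set.mapsTo_iff_image_subset.2 h).iterate k).image_subset

section TopDyn

variable {U : Type*} [TopologicalSpace U]

theorem irrComps_subset_of_sUnion {Z : Set U} {S : Set (Set U)} (hS : S.Finite)
    (hcl : ∀ s ∈ S, IsClosed s) (hirr : ∀ s ∈ S, IsIrreducible s) (hZ : Z = ⋃₀ S) :
    irrComps Z ⊆ S := by
  intro C hC
  obtain ⟨⟨hCZ, hCirr, -⟩, hmax⟩ := hC
  obtain ⟨s, hs, hCs⟩ := (isIrreducible_iff_sUnion_isClosed.1 hCirr) hS.toFinset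
    (fun s hs => hcl s (hS.mem_toFinset.1 hs)) (by simpa [← hZ] using hCZ)
  rw [hS.mem_toFinset] at hs
  have hsC := hmax ⟨hZ ▸ Set.subset_sUnion_of_mem hs, hirr s hs, hcl s hs⟩ hCs
  rwa [Set.Subset.antisymm hCs hsC]

theorem irrComps_finite_and_sUnion [TopologicalSpace.NoetherianSpace U] {Z : Set U}
    (hZ : IsClosed Z) : (irrComps Z).Finite ∧ ⋃₀ irrComps Z = Z := by
  obtain ⟨S, hS, hcl, hirr, hZS⟩ :=
    TopologicalSpace.NoetherianSpace.exists_finite_set_isClosed_irreducible hZ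
  have hsub := irrComps_subset_of_sUnion hS hcl hirr hZS
  refine ⟨hS.subset hsub, Set.Subset.antisymm (Set.sUnion_subset fun C hC => hC.1.1) ?_⟩
  intro x hx
  rw [hZS] at hx
  obtain ⟨s, hs, hxs⟩ := hx
  obtain ⟨t, hst, ht⟩ := hS.exists_le_maximal hs
  refine ⟨t, ⟨⟨?_, hirr t ht.prop, hcl t ht.prop⟩, ?_⟩, hst hxs⟩
  · rw [hZS]
    exact Set.subset_sUnion_of_mem ht.prop
  · rintro C ⟨hCZ, hCirr, -⟩ htC
    obtain ⟨r, hr, hCr⟩ := (isIrreducible_iff_sUnion_isClosed.1 hCirr) hS.toFinset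
      (fun s hs => hcl s (hS.mem_toFinset.1 hs)) (by simpa [← hZS] using hCZ)
    exact hCr.trans (ht.2 (hS.mem_toFinset.1 hr) (htC.trans hCr))

theorem IsPeriodicUnder.sUnion {α : Type*} {Φ : α → α} {T : Set (Set α)}
    (hT : T.Finite) (h : ∀ Y ∈ T, IsPeriodicUnder Φ Y) : IsPeriodicUnder Φ (⋃₀ T) := by
  choose! n hn1 hn using h
  refine ⟨∏ Y ∈ hT.toFinset, n Y,
    Nat.one_le_iff_ne_zero.2 (Finset.prod_ne_zero_iff.2 fun Y hY =>
      Nat.one_le_iff_ne_zero.1 (hn1 Y (hT.mem_toFinset.1 hY))), ?_⟩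
  rintro _ ⟨x, ⟨Y, hY, hx⟩, rfl⟩
  obtain ⟨k, hk⟩ := Finset.dvd_prod_of_mem n (hT.mem_toFinset.2 hY)
  rw [hk]
  exact ⟨Y, hY, image_iterate_mul_subset (hn Y hY) k ⟨x, hx, rfl⟩⟩

theorem isPeriodicUnder_PPhi [TopologicalSpace.NoetherianSpace U] (Φ : U → U) {Z : Set U}
    (hZ : IsClosed Z) : IsPeriodicUnder Φ (PPhi Φ Z) := by
  refine IsPeriodicUnder.sUnion (((irrComps_finite_and_sUnion hZ).1.powerset.image
    Set.sUnion).subset ?_) fun Y hY => hY.2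
  rintro _ ⟨⟨S, hS, rfl⟩, -⟩
  exact ⟨S, hS, rfl⟩

theorem nonPeriodicComps_nonempty [TopologicalSpace.NoetherianSpace U] {Φ : U → U} {Z : Set U}
    (hZ : IsClosed Z) (hnp : ¬ IsPeriodicUnder Φ Z) : (nonPeriodicComps Φ Z).Nonempty := by
  by_contra hempty
  refine hnp ?_
  have hsub : Z ⊆ PPhi Φ Z := by
    rw [← (irrComps_finite_and_sUnion hZ).2]
    refine Set.sUnion_subset fun C hC => ?_
    rw [(irrComps_finite_and_sUnion hZ).2]
    by_contra hCP
    exact hempty ⟨C, hC, hCP⟩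
  have hsub' : PPhi Φ Z ⊆ Z := by
    rintro x ⟨_, ⟨⟨S, hS, rfl⟩, -⟩, C, hC, hx⟩
    exact (hS hC).1.1 hx
  rw [hsub.antisymm hsub']
  exact isPeriodicUnder_PPhi Φ hZ

theorem topologicalKrullDim_coe_le (Y : Set U) : topologicalKrullDim Y ≤ topologicalKrullDim U :=
  Topology.IsInducing.subtypeVal.topologicalKrullDim_le

theorem topologicalKrullDim_nonneg {X : Type*} [TopologicalSpace X] [Nonempty X] :
    0 ≤ topologicalKrullDim X := by
  have : Nonempty (TopologicalSpace.IrreducibleCloseds X) :=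
    ⟨⟨closure {Classical.arbitrary X}, isIrreducible_singleton.closure, isClosed_closure⟩⟩
  exact Order.krullDim_nonneg

theorem stabDim_nonneg (Φ : U → U) {C : Set U} (hC : C.Nonempty) : 0 ≤ stabDim Φ C := by
  refine le_iInf fun n => ?_
  have := (hC.image Φ^[n]).closure.to_subtype
  exact topologicalKrullDim_nonneg

theorem stabDim_le (Φ : U → U) (C : Set U) : stabDim Φ C ≤ topologicalKrullDim U :=
  iInf_le_of_le 0 (topologicalKrullDim_coe_le _)

theorem nuDim_mem_Icc [TopologicalSpace.NoetherianSpace U] {Φ : U → U} {Z : Set U}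
    (hZ : IsClosed Z) (hnp : ¬ IsPeriodicUnder Φ Z) :
    (nuDim Φ Z).1 ∈ Set.Icc 0 (topologicalKrullDim U) ∧
      (nuDim Φ Z).2 ∈ Set.Icc 0 (topologicalKrullDim U) := by
  classical
  have hne := nonPeriodicComps_nonempty hZ hnp
  have hfin : (nonPeriodicComps Φ Z).Finite :=
    (irrComps_finite_and_sUnion hZ).1.subset fun C hC => hC.1
  obtain ⟨C, hC, hmax⟩ := hfin.exists_maximalFor (stabDim Φ) _ hne
  have hCne : C.Nonempty := hC.1.1.2.1.nonempty
  have hD : stabDim Φ C = ⨆ C ∈ nonPeriodicComps Φ Z, stabDim Φ C :=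
    le_antisymm (le_iSup₂_of_le C hC le_rfl) <| iSup₂_le fun C' hC' =>
      (le_total (stabDim Φ C') (stabDim Φ C)).elim id (hmax hC')
  have := hCne.to_subtype
  refine ⟨⟨(stabDim_nonneg Φ hCne).trans hD.le, iSup₂_le fun C _ => stabDim_le Φ C⟩, ?_, ?_⟩
  · refine le_iSup₂_of_le C hC ?_
    rw [if_pos hD]
    exact topologicalKrullDim_nonneg
  · refine iSup₂_le fun C' _ => ?_
    split_ifs
    · exact topologicalKrullDim_coe_le _
    · exact bot_le

end TopDyn

theorem WithBot.exists_nat_eq_of_mem_Icc {d : ℕ} {x : WithBot ℕ∞}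
    (hx : x ∈ Set.Icc 0 (((d : ℕ∞) : WithBot ℕ∞))) :
    ∃ k : ℕ, k ≤ d ∧ x = ((k : ℕ∞) : WithBot ℕ∞) := by
  obtain ⟨h0, hd⟩ := hx
  lift x to ℕ∞ using (fun h => by simp [h] at h0)
  rw [WithBot.coe_le_coe] at hd
  lift x to ℕ using (ne_top_of_le_ne_top (ENat.natCast_ne_top d) hd)
  exact ⟨x, by exact_mod_cast hd, rfl⟩

/-- **Lemma 3.9 of Bell–Hu–Satriano**: let `U` be a non-empty Noetherian topological space
of Krull dimension `d` and `Φ : U → U` a continuous map. If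
`Z₀ ⊇ Z₁ ⊇ ⋯ ⊇ Z_m` is a descending chain of non-periodic closed subsets of `U` with
`ν(Z₀) ≻ ν(Z₁) ≻ ⋯ ≻ ν(Z_m)`, then `m < (d + 1)²`. -/
theorem nu_chain_bound
    {U : Type*} [TopologicalSpace U] [TopologicalSpace.NoetherianSpace U] [Nonempty U]
    (d : ℕ) (hdim : topologicalKrullDim U = (d : ℕ∞))
    (Φ : U → U) (hΦ : Continuous Φ)
    (m : ℕ) (Z : ℕ → Set U)
    (hcl : ∀ i ≤ m, IsClosed (Z i))
    (hchain : ∀ i < m, Z (i + 1) ⊆ Z i)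
    (hnp : ∀ i ≤ m, ¬ IsPeriodicUnder Φ (Z i))
    (hdec : ∀ i < m, nuLt (nuDim Φ (Z (i + 1))) (nuDim Φ (Z i))) :
    m < (d + 1) ^ 2 := by
  have hcode (i : ℕ) : ∃ a b : ℕ, i ≤ m → a ≤ d ∧ b ≤ d ∧
      nuDim Φ (Z i) = (((a : ℕ∞) : WithBot ℕ∞), ((b : ℕ∞) : WithBot ℕ∞)) := by
    by_cases hi : i ≤ m
    · obtain ⟨h1, h2⟩ := nuDim_mem_Icc (hcl i hi) (hnp i hi)
      rw [hdim] at h1 h2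
      obtain ⟨a, ha, ha'⟩ := WithBot.exists_nat_eq_of_mem_Icc h1
      obtain ⟨b, hb, hb'⟩ := WithBot.exists_nat_eq_of_mem_Icc h2
      exact ⟨a, b, fun _ => ⟨ha, hb, Prod.ext ha' hb'⟩⟩
    · exact ⟨0, 0, fun h => absurd h hi⟩
  choose a b hab using hcode
  have hstep (i : ℕ) (hi : i < m) :
      a (i + 1) * (d + 1) + b (i + 1) < a i * (d + 1) + b i := by
    obtain ⟨-, -, h⟩ := hab i hi.le
    obtain ⟨-, hb', h'⟩ := hab (i + 1) hi
    have hlt := hdec i hi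
    rw [h, h', nuLt] at hlt
    dsimp only at hlt
    norm_cast at hlt
    rcases hlt with hlt | ⟨heq, hlt⟩
    · nlinarith
    · rw [heq]
      lia
  have hsum (i : ℕ) (hi : i ≤ m) : a i * (d + 1) + b i + i ≤ a 0 * (d + 1) + b 0 := by
    induction i with
    | zero => rfl
    | succ i ih =>
      have := hstep i hi
      have := ih (by lia)
      lia
  obtain ⟨ha0, hb0, -⟩ := hab 0 m.zero_le
  have := hsum m le_rfl
  nlinarith
end

section
/- Let U be a Noetherian topological space, Φ : U → U a continuous map, Z ⊆ U a closed subset, and L ≥ 1 an integer with Φ^L(P_Φ(Z)) ⊆ P_Φ(Z). Then for every j ∈ ℕ that is a multiple of L, every irreducible component of Z contained in P_Φ(Z) is also an irreducible component of Z ∩ Φ^{−j}(Z), and consequently P_Φ(Z) ⊆ P_Φ(Z ∩ Φ^{−j}(Z)). -/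
section TopDyn

variable {U : Type*} [TopologicalSpace U] {Φ : U → U} {Z W : Set U}

theorem subset_of_mem_irrComps {C : Set U} (hC : C ∈ irrComps Z) : C ⊆ Z :=
  hC.1.1

theorem PPhi_subset : PPhi Φ Z ⊆ Z := by
  rintro x ⟨_, ⟨⟨S, hS, rfl⟩, -⟩, C, hC, hx⟩
  exact subset_of_mem_irrComps (hS hC) hx

/-- An irreducible component of `Z` contained in a subset `W` of `Z` is one of `W`. -/
theorem mem_irrComps_of_subset {C : Set U} (hC : C ∈ irrComps Z) (hCW : C ⊆ W) (hWZ : W ⊆ Z) :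
    C ∈ irrComps W := by
  rw [irrComps, Set.mem_ofPred_eq] at hC ⊢
  exact hC.mono (fun _ hS => ⟨hS.1.trans hWZ, hS.2⟩) ⟨hCW, hC.prop.2⟩

theorem PPhi_eq_sUnion : PPhi Φ Z = ⋃₀ {C ∈ irrComps Z | C ⊆ PPhi Φ Z} := by
  refine Set.Subset.antisymm ?_ (Set.sUnion_subset fun C hC => hC.2)
  rintro x ⟨_, ⟨⟨S, hS, rfl⟩, hper⟩, C, hC, hx⟩
  exact ⟨C, ⟨hS hC, (Set.subset_sUnion_of_mem hC).trans
    (Set.subset_sUnion_of_mem ⟨⟨S, hS, rfl⟩, hper⟩)⟩, hx⟩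

end TopDyn

/-- **Equation (3.1) in Step 2 of the proof of Theorem 1.4 of Bell–Hu–Satriano**: let `U`
be a Noetherian topological space, `Φ : U → U` continuous, `Z ⊆ U` closed, and `L ≥ 1`
with `Φ^L(P_Φ(Z)) ⊆ P_Φ(Z)`. Then for every `j ∈ ℕ` that is a multiple of `L`, every
irreducible component of `Z` contained in `P_Φ(Z)` is also an irreducible component of
`Z ∩ Φ^{−j}(Z)`, and consequently `P_Φ(Z) ⊆ P_Φ(Z ∩ Φ^{−j}(Z))`. -/
theorem PPhi_subset_PPhi_inter_preimage
    {U : Type*} [TopologicalSpace U] [TopologicalSpace.NoetherianSpace U]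
    (Φ : U → U) (hΦ : Continuous Φ)
    (Z : Set U) (hZ : IsClosed Z)
    (L : ℕ) (hL : 1 ≤ L) (hP : Φ^[L] '' PPhi Φ Z ⊆ PPhi Φ Z)
    (j : ℕ) (hj : L ∣ j) :
    (∀ C ∈ irrComps Z, C ⊆ PPhi Φ Z → C ∈ irrComps (Z ∩ Φ^[j] ⁻¹' Z)) ∧
      PPhi Φ Z ⊆ PPhi Φ (Z ∩ Φ^[j] ⁻¹' Z) := by
  obtain ⟨k, rfl⟩ := hj
  have hmaps : Set.MapsTo Φ^[L * k] (PPhi Φ Z) (PPhi Φ Z) := by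
    rw [Function.iterate_mul]
    exact (Set.mapsTo_iff_image_subset.2 hP).iterate k
  have hcomp : ∀ C ∈ irrComps Z, C ⊆ PPhi Φ Z → C ∈ irrComps (Z ∩ Φ^[L * k] ⁻¹' Z) :=
    fun C hC hCP => mem_irrComps_of_subset hC
      (fun _ hx => ⟨subset_of_mem_irrComps hC hx,
        Set.mem_preimage.2 (PPhi_subset (hmaps (hCP hx)))⟩) Set.inter_subset_left
  exact ⟨hcomp, Set.subset_sUnion_of_mem
    ⟨⟨_, fun C hC => hcomp C hC.1 hC.2, PPhi_eq_sUnion⟩, L, hL, hP⟩⟩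
end
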